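/- arXiv:2308.05299 — 3 statements merged into one kernel-verified Lean document; each statement's English description precedes it below -/
import Mathlib

section
/- Let (R, 𝔪) be a gr-local ℤ-graded Noetherian domain that is a gr-(R₁) domain, such that for every height-one homogeneous prime P of the integral closure R′ of R, the contraction P ∩ R is a height-one homogeneous prime of R. Let S be a graded overring of R that is integral over R and satisfies graded going-down (gGD) over R. Then S is gr-local. -/
/-! Core definitions for graded perinormality, following Epstein–Shapiro style graded notions. -/

section Core

variable {ι : Type*} [DecidableEq ι] [AddCommMonoid ι]
variable {R : Type*} [CommRing R]

/-- `𝒜` is a grading of the ring `R` by the (torsionless) monoid `ι`: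
the components multiply correctly and give an internal direct sum decomposition. -/
structure IsGrRing (𝒜 : ι → AddSubgroup R) : Prop where
  one_mem : (1 : R) ∈ 𝒜 0
  mul_mem : ∀ {i j : ι} {a b : R}, a ∈ 𝒜 i → b ∈ 𝒜 j → a * b ∈ 𝒜 (i + j)
  internal : DirectSum.IsInternal 𝒜

/-- An ideal of `R` is homogeneous iff every element of it is a finite sum of
homogeneous elements of the ideal. -/
def IsHomIdeal (𝒜 : ι → AddSubgroup R) (I : Ideal R) : Prop :=
  ∀ x ∈ I, x ∈ AddSubmonoid.closure {y : R | SetLike.IsHomogeneousElem 𝒜 y ∧ y ∈ I}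

/-- A graded (homogeneous) maximal ideal: maximal among proper homogeneous ideals. -/
def IsGrMaxIdeal (𝒜 : ι → AddSubgroup R) (I : Ideal R) : Prop :=
  IsHomIdeal 𝒜 I ∧ I ≠ ⊤ ∧ ∀ J : Ideal R, IsHomIdeal 𝒜 J → I ≤ J → J ≠ ⊤ → J = I

/-- `R` is gr-local: it has exactly one graded maximal ideal. -/
def GrLocal (𝒜 : ι → AddSubgroup R) : Prop :=
  ∃! I : Ideal R, IsGrMaxIdeal 𝒜 I

/-- A prime ideal of height one (in a domain). -/
def HeightOnePrime (P : Ideal R) : Prop :=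
  P.IsPrime ∧ P ≠ ⊥ ∧ ∀ Q : Ideal R, Q.IsPrime → Q < P → Q = ⊥

variable [IsDomain R]

/-- A homogeneous element of the graded quotient field of `R`, i.e. a quotient of two
homogeneous elements of `R` (viewed inside the full quotient field). -/
def IsHomFrac (𝒜 : ι → AddSubgroup R) (x : FractionRing R) : Prop :=
  ∃ (i j : ι) (a b : R), a ∈ 𝒜 i ∧ b ∈ 𝒜 j ∧ b ≠ 0 ∧
    x * algebraMap R (FractionRing R) b = algebraMap R (FractionRing R) a

/-- `S` is a graded overring of `R`: a ring between `R` and the graded quotient field that is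
the sum of its homogeneous components, i.e. each of its elements is a finite sum of
homogeneous elements of `S`. -/
def IsGradedOverring (𝒜 : ι → AddSubgroup R) (S : Subalgebra R (FractionRing R)) : Prop :=
  ∀ x ∈ S, x ∈ AddSubmonoid.closure {y : FractionRing R | y ∈ S ∧ IsHomFrac 𝒜 y}

/-- A homogeneous ideal of an overring `S` of `R`. -/
def IsHomIdealOver (𝒜 : ι → AddSubgroup R) (S : Subalgebra R (FractionRing R))
    (I : Ideal S) : Prop :=
  ∀ x ∈ I, (x : FractionRing R) ∈ AddSubmonoid.closure
    {y : FractionRing R | IsHomFrac 𝒜 y ∧ ∃ h : y ∈ S, (⟨y, h⟩ : S) ∈ I}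

/-- A graded maximal ideal of an overring. -/
def IsGrMaxIdealOver (𝒜 : ι → AddSubgroup R) (S : Subalgebra R (FractionRing R))
    (I : Ideal S) : Prop :=
  IsHomIdealOver 𝒜 S I ∧ I ≠ ⊤ ∧
    ∀ J : Ideal S, IsHomIdealOver 𝒜 S J → I ≤ J → J ≠ ⊤ → J = I

/-- The overring `S` is gr-local. -/
def GrLocalOver (𝒜 : ι → AddSubgroup R) (S : Subalgebra R (FractionRing R)) : Prop :=
  ∃! I : Ideal S, IsGrMaxIdealOver 𝒜 S I

/-- `S` satisfies graded going-down (gGD) over `R`. -/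
def GGD (𝒜 : ι → AddSubgroup R) (S : Subalgebra R (FractionRing R)) : Prop :=
  ∀ (P Q : Ideal R) (Qt : Ideal S), P.IsPrime → Q.IsPrime → Qt.IsPrime →
    IsHomIdeal 𝒜 P → IsHomIdeal 𝒜 Q → IsHomIdealOver 𝒜 S Qt → P ≤ Q →
    Qt.comap (algebraMap R S) = Q →
    ∃ Pt : Ideal S, Pt.IsPrime ∧ IsHomIdealOver 𝒜 S Pt ∧ Pt ≤ Qt ∧
      Pt.comap (algebraMap R S) = P

/-- The overring `S` is a localization of `R` (at some multiplicative subset `W` of `R`). -/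
def IsLocalizationOfR (S : Subalgebra R (FractionRing R)) : Prop :=
  ∃ W : Submonoid R, (∀ w ∈ W, IsUnit (algebraMap R S w)) ∧
    ∀ s : S, ∃ (r w : R), w ∈ W ∧ s * algebraMap R S w = algebraMap R S r

/-- `R` is a graded perinormal domain: every gr-local graded overring satisfying gGD is a
localization of `R`. -/
def GradedPerinormal (𝒜 : ι → AddSubgroup R) : Prop :=
  ∀ S : Subalgebra R (FractionRing R),
    IsGradedOverring 𝒜 S → GrLocalOver 𝒜 S → GGD 𝒜 S → IsLocalizationOfR S

/-- `R` is a graded globally perinormal domain: every graded overring satisfying gGD is a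
localization of `R`. -/
def GradedGloballyPerinormal (𝒜 : ι → AddSubgroup R) : Prop :=
  ∀ S : Subalgebra R (FractionRing R),
    IsGradedOverring 𝒜 S → GGD 𝒜 S → IsLocalizationOfR S

/-- The homogeneous localization `R_(P)` of `R` at an ideal `P`: the subring of the graded
quotient field consisting of fractions with homogeneous denominator outside `P`. -/
def HomLocR (𝒜 : ι → AddSubgroup R) (P : Ideal R) : Subalgebra R (FractionRing R) :=
  Algebra.adjoin R {x : FractionRing R | ∃ a w : R, SetLike.IsHomogeneousElem 𝒜 w ∧ w ∉ P ∧
    x * algebraMap R (FractionRing R) w = algebraMap R (FractionRing R) a}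

/-- The homogeneous localization `S_(Q)` of an overring `S` at an ideal `Q` of `S`. -/
def HomLocOver (𝒜 : ι → AddSubgroup R) (S : Subalgebra R (FractionRing R)) (Q : Ideal S) :
    Subalgebra R (FractionRing R) :=
  Algebra.adjoin R {x : FractionRing R | ∃ s w : S, IsHomFrac 𝒜 (w : FractionRing R) ∧
    w ∉ Q ∧ x * (w : FractionRing R) = (s : FractionRing R)}

/-- The localization `R_W` of `R` at a multiplicative set `W`, as a subring of the quotient
field. -/
def LocW (W : Submonoid R) : Subalgebra R (FractionRing R) :=
  Algebra.adjoin R {x : FractionRing R | ∃ r : R, ∃ w ∈ W,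
    x * algebraMap R (FractionRing R) w = algebraMap R (FractionRing R) r}

/-- A subring `V` of the graded quotient field (containing `R`) is a gr-valuation domain:
for every nonzero homogeneous `x` of the graded quotient field, `x ∈ V` or `x⁻¹ ∈ V`. -/
def GrValuation (𝒜 : ι → AddSubgroup R) (V : Subalgebra R (FractionRing R)) : Prop :=
  ∀ x : FractionRing R, x ≠ 0 → IsHomFrac 𝒜 x → x ∈ V ∨ x⁻¹ ∈ V

/-- `R` is a gr-(R₁) domain: the homogeneous localization at every height-one homogeneous
prime is a gr-valuation domain. -/
def GrR1 (𝒜 : ι → AddSubgroup R) : Prop :=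
  ∀ P : Ideal R, HeightOnePrime P → IsHomIdeal 𝒜 P → GrValuation 𝒜 (HomLocR 𝒜 P)

/-- The ideal `I` of `T` is the contraction of the ideal `J` of `S` (that is, `I = J ∩ T`
inside the common quotient field). -/
def Contracts (T S : Subalgebra R (FractionRing R)) (J : Ideal S) (I : Ideal T) : Prop :=
  ∀ x : FractionRing R,
    (∃ h : x ∈ T, (⟨x, h⟩ : T) ∈ I) ↔ (x ∈ T ∧ ∃ h : x ∈ S, (⟨x, h⟩ : S) ∈ J)

/-- `S` satisfies graded going-down over the intermediate ring `T`. -/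
def GGDSub (𝒜 : ι → AddSubgroup R) (T S : Subalgebra R (FractionRing R)) : Prop :=
  ∀ (P Q : Ideal T) (Qt : Ideal S), P.IsPrime → Q.IsPrime → Qt.IsPrime →
    IsHomIdealOver 𝒜 T P → IsHomIdealOver 𝒜 T Q → IsHomIdealOver 𝒜 S Qt → P ≤ Q →
    Contracts T S Qt Q →
    ∃ Pt : Ideal S, Pt.IsPrime ∧ IsHomIdealOver 𝒜 S Pt ∧ Pt ≤ Qt ∧ Contracts T S Pt P

/-- `S` is a localization of the intermediate ring `T` at a multiplicative subset of `T`. -/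
def IsLocalizationOfSub (T S : Subalgebra R (FractionRing R)) : Prop :=
  ∃ W : Submonoid (FractionRing R), (W : Set (FractionRing R)) ⊆ T ∧
    (∀ w ∈ W, ∃ y ∈ S, w * y = 1) ∧ ∀ s ∈ S, ∃ t ∈ T, ∃ w ∈ W, s * w = t

/-- The intermediate ring `T` (e.g. a homogeneous localization of `R`) is a graded
perinormal domain. -/
def GradedPerinormalSub (𝒜 : ι → AddSubgroup R) (T : Subalgebra R (FractionRing R)) : Prop :=
  ∀ S : Subalgebra R (FractionRing R), T ≤ S → IsGradedOverring 𝒜 S → GrLocalOver 𝒜 S →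
    GGDSub 𝒜 T S → IsLocalizationOfSub T S

/-- The intermediate ring `T` is a graded globally perinormal domain. -/
def GradedGloballyPerinormalSub (𝒜 : ι → AddSubgroup R)
    (T : Subalgebra R (FractionRing R)) : Prop :=
  ∀ S : Subalgebra R (FractionRing R), T ≤ S → IsGradedOverring 𝒜 S →
    GGDSub 𝒜 T S → IsLocalizationOfSub T S

/-- `R` is a gr-essential domain: `R` is the intersection of homogeneous localizations at a
family of homogeneous primes, each of which is a gr-valuation domain. -/
def GrEssential (𝒜 : ι → AddSubgroup R) : Prop :=
  ∃ I : Set (Ideal R),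
    (∀ P ∈ I, P.IsPrime ∧ IsHomIdeal 𝒜 P ∧ GrValuation 𝒜 (HomLocR 𝒜 P)) ∧
    ((⊥ : Subalgebra R (FractionRing R)) : Set (FractionRing R)) =
      ⋂ P ∈ I, (HomLocR 𝒜 P : Set (FractionRing R))

/-- The intermediate ring `T` is a gr-essential domain. -/
def GrEssentialSub (𝒜 : ι → AddSubgroup R) (T : Subalgebra R (FractionRing R)) : Prop :=
  ∃ I : Set (Ideal T),
    (∀ P ∈ I, P.IsPrime ∧ IsHomIdealOver 𝒜 T P ∧ GrValuation 𝒜 (HomLocOver 𝒜 T P)) ∧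
    (T : Set (FractionRing R)) = ⋂ P ∈ I, (HomLocOver 𝒜 T P : Set (FractionRing R))

end Core

open LaurentPolynomial DirectSum

section GradedRings

variable {A : Type*} [CommRing A] {𝒞 : ℤ → AddSubgroup A}

/-- The Mathlib graded ring structure underlying `IsGrRing`. -/
@[reducible]
noncomputable def IsGrRing.gradedRing (h : IsGrRing 𝒞) : GradedRing 𝒞 :=
  { h.internal.chooseDecomposition with
    one_mem := h.one_mem
    mul_mem := fun _ _ _ _ ha hb => h.mul_mem ha hb }

theorem isHomIdeal_iff_isHomogeneous [GradedRing 𝒞] {I : Ideal A} :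
    IsHomIdeal 𝒞 I ↔ I.IsHomogeneous 𝒞 := by
  classical
  constructor
  · intro h i x hx
    replace hx := h x hx
    induction hx using AddSubmonoid.closure_induction with
    | mem y hy =>
      obtain ⟨⟨j, hj⟩, hyI⟩ := hy
      by_cases hij : j = i
      · subst hij
        rwa [decompose_of_mem_same 𝒞 hj]
      · rw [decompose_of_mem_ne 𝒞 hj hij]
        exact I.zero_mem
    | zero => simp
    | add y z _ _ hy hz =>
      rw [decompose_add, DirectSum.add_apply, AddSubgroup.coe_add]
      exact I.add_mem hy hz
  · intro h x hx
    rw [← sum_support_decompose 𝒞 x]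
    exact sum_mem fun i _ => AddSubmonoid.subset_closure ⟨⟨i, SetLike.coe_mem _⟩, h i hx⟩

/-- Every prime ideal contains a homogeneous prime ideal with the same homogeneous elements. -/
theorem IsGrRing.exists_homogeneous_prime_le (h : IsGrRing 𝒞) {P : Ideal A} (hP : P.IsPrime) :
    ∃ P₀ : Ideal A, P₀.IsPrime ∧ IsHomIdeal 𝒞 P₀ ∧ P₀ ≤ P ∧
      ∀ I : Ideal A, IsHomIdeal 𝒞 I → I ≤ P → I ≤ P₀ := by
  let := h.gradedRing
  refine ⟨(P.homogeneousCore 𝒞).toIdeal, hP.homogeneousCore, ?_, P.toIdeal_homogeneousCore_le 𝒞,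
    fun I hI hIP => ?_⟩
  · exact isHomIdeal_iff_isHomogeneous.2 (P.homogeneousCore 𝒞).isHomogeneous
  · rw [isHomIdeal_iff_isHomogeneous] at hI
    rw [← hI.toIdeal_homogeneousCore_eq_self]
    exact Ideal.homogeneousCore_mono 𝒞 hIP

theorem IsGrMaxIdeal.isPrime (h : IsGrRing 𝒞) {I : Ideal A} (hI : IsGrMaxIdeal 𝒞 I) :
    I.IsPrime := by
  obtain ⟨M, hM, hIM⟩ := I.exists_le_maximal hI.2.1
  obtain ⟨P, hP, hPhom, -, hle⟩ := h.exists_homogeneous_prime_le hM.isPrime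
  rw [← hI.2.2 P hPhom (hle I hI.1 hIM) hP.ne_top]
  exact hP

theorem IsHomIdeal.sSup {s : Set (Ideal A)} (hs : ∀ I ∈ s, IsHomIdeal 𝒞 I) :
    IsHomIdeal 𝒞 (sSup s) := by
  intro x hx
  rw [sSup_eq_iSup', ← Submodule.mem_toAddSubmonoid, Submodule.iSup_toAddSubmonoid] at hx
  induction hx using AddSubmonoid.iSup_induction' with
  | mem I x hx =>
    refine AddSubmonoid.closure_mono ?_ (hs I I.2 x hx)
    exact fun y hy => ⟨hy.1, (le_sSup I.2 : I.1 ≤ _) hy.2⟩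
  | zero => exact zero_mem _
  | add _ _ _ _ hx hy => exact add_mem hx hy

theorem exists_isGrMaxIdeal_ge {I : Ideal A} (hI : IsHomIdeal 𝒞 I) (hne : I ≠ ⊤) :
    ∃ M, IsGrMaxIdeal 𝒞 M ∧ I ≤ M := by
  have key : ∀ c ⊆ {J : Ideal A | IsHomIdeal 𝒞 J ∧ J ≠ ⊤}, IsChain (· ≤ ·) c → ∀ J ∈ c,
      ∃ ub ∈ {J : Ideal A | IsHomIdeal 𝒞 J ∧ J ≠ ⊤}, ∀ K ∈ c, K ≤ ub := by
    intro c hc hchain J hJ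
    refine ⟨sSup c, ⟨IsHomIdeal.sSup fun K hK => (hc hK).1, ?_⟩, fun K hK => le_sSup hK⟩
    rw [Ideal.ne_top_iff_one, Submodule.mem_sSup_of_directed ⟨J, hJ⟩ hchain.directedOn]
    rintro ⟨K, hK, h1⟩
    exact (hc hK).2 ((Ideal.eq_top_iff_one K).2 h1)
  obtain ⟨M, hIM, hM⟩ := zorn_le_nonempty₀ _ key I ⟨hI, hne⟩
  exact ⟨M, ⟨hM.prop.1, hM.prop.2, fun J hJ hMJ hJ' => (hM.eq_of_le ⟨hJ, hJ'⟩ hMJ).symm⟩, hIM⟩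

theorem IsHomIdeal.sup {I J : Ideal A} (hI : IsHomIdeal 𝒞 I) (hJ : IsHomIdeal 𝒞 J) :
    IsHomIdeal 𝒞 (I ⊔ J) := by
  rw [← sSup_pair]
  exact IsHomIdeal.sSup (by rintro K (rfl | rfl) <;> assumption)

variable {B : Type*} [CommRing B] {𝒟 : ℤ → AddSubgroup B}

theorem IsHomIdeal.comap (h𝒞 : IsGrRing 𝒞) (h𝒟 : IsGrRing 𝒟) {f : A →+* B}
    (hf : ∀ i, ∀ a ∈ 𝒞 i, f a ∈ 𝒟 i) {I : Ideal B} (hI : IsHomIdeal 𝒟 I) :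
    IsHomIdeal 𝒞 (I.comap f) := by
  let := h𝒞.gradedRing
  let := h𝒟.gradedRing
  let g : 𝒞 →+*ᵍ 𝒟 := { f with map_mem := fun {i a} ha => hf i a ha }
  rw [isHomIdeal_iff_isHomogeneous] at hI ⊢
  exact (HomogeneousIdeal.comap g ⟨I, hI⟩).isHomogeneous

theorem IsHomIdeal.map (h𝒞 : IsGrRing 𝒞) (h𝒟 : IsGrRing 𝒟) {f : A →+* B}
    (hf : ∀ i, ∀ a ∈ 𝒞 i, f a ∈ 𝒟 i) {I : Ideal A} (hI : IsHomIdeal 𝒞 I) :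
    IsHomIdeal 𝒟 (I.map f) := by
  let := h𝒞.gradedRing
  let := h𝒟.gradedRing
  let g : 𝒞 →+*ᵍ 𝒟 := { f with map_mem := fun {i a} ha => hf i a ha }
  rw [isHomIdeal_iff_isHomogeneous] at hI ⊢
  exact (HomogeneousIdeal.map g ⟨I, hI⟩).isHomogeneous

end GradedRings

section LaurentPolynomials

theorem LaurentPolynomial.coeff_mul_add_of_top {K : Type*} [CommRing K] {f g : K[T;T⁻¹]} {N M : ℤ}
    (hf : ∀ i, N < i → f.coeff i = 0) (hg : ∀ i, M < i → g.coeff i = 0) :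
    (f * g).coeff (N + M) = f.coeff N * g.coeff M := by
  rw [AddMonoidAlgebra.coeff_mul_apply_left, Finsupp.sum, Finset.sum_eq_single N]
  · simp
  · intro i _ hi
    rcases lt_or_gt_of_ne hi with h | h
    · rw [hg _ (by lia), mul_zero]
    · rw [hf _ h, zero_mul]
  · intro h
    rw [Finsupp.notMem_support_iff.1 h, zero_mul]

theorem LaurentPolynomial.coeff_mul_eq_zero_of_top {K : Type*} [CommRing K] {f g : K[T;T⁻¹]}
    {N M : ℤ} (hf : ∀ i, N < i → f.coeff i = 0) (hg : ∀ i, M < i → g.coeff i = 0) (k : ℤ)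
    (hk : N + M < k) : (f * g).coeff k = 0 := by
  rw [AddMonoidAlgebra.coeff_mul_apply_left, Finsupp.sum]
  refine Finset.sum_eq_zero fun i _ => ?_
  rcases lt_or_ge N i with h | h
  · rw [hf _ h, zero_mul]
  · rw [hg _ (by lia), mul_zero]

theorem LaurentPolynomial.coeff_pow_of_top {K : Type*} [CommRing K] {f : K[T;T⁻¹]} {N : ℤ}
    (hf : ∀ i, N < i → f.coeff i = 0) (n : ℕ) :
    (∀ i, n * N < i → (f ^ n).coeff i = 0) ∧ (f ^ n).coeff (n * N) = f.coeff N ^ n := by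
  induction n with
  | zero =>
    refine ⟨fun i hi => ?_, ?_⟩
    · rw [pow_zero, ← LaurentPolynomial.T_zero, LaurentPolynomial.T_apply, if_neg]
      simp at hi
      lia
    · rw [pow_zero, ← LaurentPolynomial.T_zero, LaurentPolynomial.T_apply, if_pos (by simp),
        pow_zero]
  | succ n ih =>
    have h : ((n + 1 : ℕ) : ℤ) * N = n * N + N := by push_cast; ring
    rw [h, pow_succ, pow_succ]
    exact ⟨coeff_mul_eq_zero_of_top ih.1 hf,
      by rw [coeff_mul_add_of_top ih.1 hf, ih.2]⟩

theorem LaurentPolynomial.exists_top {K : Type*} [CommRing K] {f : K[T;T⁻¹]} (hf : f ≠ 0) :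
    ∃ N, f.coeff N ≠ 0 ∧ ∀ i, N < i → f.coeff i = 0 := by
  have hne : f.coeff.support.Nonempty := by
    rw [Finsupp.support_nonempty_iff]
    intro h
    exact hf (LaurentPolynomial.ext fun a => by rw [h]; rfl)
  refine ⟨f.coeff.support.max' hne, Finsupp.mem_support_iff.1 (Finset.max'_mem _ _), fun i hi => ?_⟩
  by_contra h
  exact absurd (Finset.le_max' _ i (Finsupp.mem_support_iff.2 h)) (not_le.2 hi)

instance LaurentPolynomial.isIntegrallyClosed {K : Type*} [Field K] :
    IsIntegrallyClosed K[T;T⁻¹] :=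
  isIntegrallyClosed_of_isLocalization (R := Polynomial K) K[T;T⁻¹]
    (Submonoid.powers Polynomial.X)
    (powers_le_nonZeroDivisors_of_noZeroDivisors Polynomial.X_ne_zero)

end LaurentPolynomials

section HomogeneousFractions

variable {R : Type*} [CommRing R] (𝒜 : ℤ → AddSubgroup R) [GradedRing 𝒜]

/-- The ring homomorphism `∑ aₙ ↦ ∑ aₙ Tⁿ` recording the homogeneous components of an element of
`R`, with coefficients in the quotient field. -/
noncomputable def gradeHom : R →+* (FractionRing R)[T;T⁻¹] :=
  (DirectSum.toSemiring
    (fun i => ((AddMonoidAlgebra.singleAddHom i).comp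
      (algebraMap R (FractionRing R)).toAddMonoidHom).comp (𝒜 i).subtype)
    ((congrArg (AddMonoidAlgebra.single (0 : ℤ)) (map_one (algebraMap R (FractionRing R)))).trans
      AddMonoidAlgebra.one_def.symm)
    (fun {i j} a b => (congrArg (AddMonoidAlgebra.single (i + j))
      (map_mul (algebraMap R (FractionRing R)) (a : R) b)).trans
      (AddMonoidAlgebra.single_mul_single ..).symm)).comp
  (decomposeRingEquiv 𝒜).toRingHom

theorem gradeHom_of_mem {n : ℤ} {a : R} (ha : a ∈ 𝒜 n) :
    gradeHom 𝒜 a = .single n (algebraMap R (FractionRing R) a) := by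
  have h : (decomposeRingEquiv 𝒜).toRingHom a = of (fun i => 𝒜 i) n ⟨a, ha⟩ :=
    decompose_of_mem 𝒜 ha
  rw [gradeHom, RingHom.comp_apply, h]
  exact toSemiring_of ..

theorem coeff_gradeHom (r : R) (n : ℤ) :
    (gradeHom 𝒜 r).coeff n = algebraMap R (FractionRing R) (decompose 𝒜 r n) := by
  classical
  induction r using Decomposition.inductionOn 𝒜 with
  | zero => simp
  | @homogeneous i m =>
    rw [gradeHom_of_mem 𝒜 m.2, AddMonoidAlgebra.coeff_single]
    by_cases h : i = n
    · subst h
      simp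
    · rw [decompose_of_mem_ne 𝒜 m.2 h]
      simp [h]
  | add a b ha hb => simp [ha, hb]

theorem gradeHom_injective : Function.Injective (gradeHom 𝒜) := by
  rw [injective_iff_map_eq_zero]
  intro r hr
  apply (decompose 𝒜).injective
  ext n
  have h := coeff_gradeHom 𝒜 r n
  rw [hr] at h
  simpa using h.symm

variable [IsDomain R]

/-- The extension of `gradeHom` to the quotient field. -/
noncomputable def fracGradeHom : FractionRing R →+* FractionRing (FractionRing R)[T;T⁻¹] :=
  IsFractionRing.lift (g := (algebraMap (FractionRing R)[T;T⁻¹] _).comp (gradeHom 𝒜))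
    ((IsFractionRing.injective (FractionRing R)[T;T⁻¹] _).comp (gradeHom_injective 𝒜))

theorem fracGradeHom_algebraMap (r : R) :
    fracGradeHom 𝒜 (algebraMap R _ r) = algebraMap _ _ (gradeHom 𝒜 r) := by
  simp [fracGradeHom]

/-- The fractions of degree `n`. -/
noncomputable def fracGrading (n : ℤ) : AddSubgroup (FractionRing R) where
  carrier := {x | fracGradeHom 𝒜 x = algebraMap (FractionRing R)[T;T⁻¹] _ (.single n x)}
  zero_mem' := by simp
  add_mem' {x y} hx hy := by
    simp only [Set.mem_ofPred_eq] at hx hy ⊢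
    rw [map_add, hx, hy, ← map_add, AddMonoidAlgebra.single_add]
  neg_mem' {x} hx := by
    simp only [Set.mem_ofPred_eq] at hx ⊢
    rw [map_neg, hx, ← map_neg, AddMonoidAlgebra.single_neg]

variable {𝒜}

theorem mem_fracGrading {n : ℤ} {x : FractionRing R} : x ∈ fracGrading 𝒜 n ↔
    fracGradeHom 𝒜 x = algebraMap (FractionRing R)[T;T⁻¹] _ (.single n x) := Iff.rfl

theorem algebraMap_mem_fracGrading {n : ℤ} {a : R} (ha : a ∈ 𝒜 n) :
    algebraMap R (FractionRing R) a ∈ fracGrading 𝒜 n := by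
  rw [mem_fracGrading, fracGradeHom_algebraMap, gradeHom_of_mem 𝒜 ha]

theorem mul_mem_fracGrading {m n : ℤ} {x y : FractionRing R} (hx : x ∈ fracGrading 𝒜 m)
    (hy : y ∈ fracGrading 𝒜 n) : x * y ∈ fracGrading 𝒜 (m + n) := by
  rw [mem_fracGrading] at *
  rw [map_mul, hx, hy, ← map_mul, AddMonoidAlgebra.single_mul_single]

theorem mem_fracGrading_of_mul_mem {m n : ℤ} {x y : FractionRing R} (hy : y ∈ fracGrading 𝒜 n)
    (hy0 : y ≠ 0) (h : x * y ∈ fracGrading 𝒜 (m + n)) : x ∈ fracGrading 𝒜 m := by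
  rw [mem_fracGrading] at *
  have h0 : fracGradeHom 𝒜 y ≠ 0 := by simpa using hy0
  refine mul_right_cancel₀ h0 ?_
  rw [← map_mul, h, hy, ← map_mul, AddMonoidAlgebra.single_mul_single]

theorem isHomFrac_iff_exists_mem_fracGrading {x : FractionRing R} :
    IsHomFrac 𝒜 x ↔ ∃ n, x ∈ fracGrading 𝒜 n := by
  constructor
  · rintro ⟨i, j, a, b, ha, hb, hb0, hx⟩
    refine ⟨i - j, mem_fracGrading_of_mul_mem (algebraMap_mem_fracGrading hb) (by simpa) ?_⟩
    rw [hx, sub_add_cancel]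
    exact algebraMap_mem_fracGrading ha
  · rintro ⟨n, hx⟩
    obtain ⟨r, s, hs, rfl⟩ := IsFractionRing.div_surjective (A := R) x
    have hs0 := nonZeroDivisors.ne_zero hs
    obtain ⟨m, hm⟩ : ∃ m, (decompose 𝒜 s m : R) ≠ 0 := by
      by_contra! h
      exact hs0 ((decompose 𝒜).injective (by ext m; simp [h m]))
    refine ⟨n + m, m, decompose 𝒜 r (n + m), decompose 𝒜 s m, SetLike.coe_mem _, SetLike.coe_mem _,
      hm, ?_⟩
    have hs' : algebraMap R (FractionRing R) s ≠ 0 := by simpa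
    have h := congrArg (· * fracGradeHom 𝒜 (algebraMap R _ s)) (mem_fracGrading.1 hx)
    simp only [← map_mul] at h
    rw [div_mul_cancel₀ _ hs', fracGradeHom_algebraMap, fracGradeHom_algebraMap, ← map_mul] at h
    have h' := IsFractionRing.injective (FractionRing R)[T;T⁻¹] _ h
    rw [← coeff_gradeHom, ← coeff_gradeHom, h', AddMonoidAlgebra.coeff_single_mul_apply]
    simp

theorem eq_zero_of_sum_fracGrading_eq_zero (s : Finset ℤ) (x : ℤ → FractionRing R)
    (hx : ∀ i, x i ∈ fracGrading 𝒜 i) (h : ∑ i ∈ s, x i = 0) : ∀ i ∈ s, x i = 0 := by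
  intro j hj
  have h1 : fracGradeHom 𝒜 (∑ i ∈ s, x i) =
      algebraMap (FractionRing R)[T;T⁻¹] _ (∑ i ∈ s, .single i (x i)) := by
    rw [map_sum, map_sum]
    exact Finset.sum_congr rfl fun i _ => hx i
  rw [h, map_zero, eq_comm] at h1
  have h2 := IsFractionRing.injective (FractionRing R)[T;T⁻¹] _ (h1.trans (map_zero _).symm)
  have h3 := congrArg (fun f => f.coeff j) h2
  simp only [AddMonoidAlgebra.coeff_sum, Finsupp.finsetSum_apply, AddMonoidAlgebra.coeff_single,
    Finsupp.single_apply, Finset.sum_ite_eq', hj, if_true] at h3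
  exact h3

/-- The elements of degree `n` of an overring `S`. -/
noncomputable def overGrading (𝒜 : ℤ → AddSubgroup R) [GradedRing 𝒜]
    (S : Subalgebra R (FractionRing R)) (n : ℤ) : AddSubgroup S :=
  (fracGrading 𝒜 n).comap S.val.toAddMonoidHom

theorem isHomogeneousElem_overGrading {S : Subalgebra R (FractionRing R)} {x : S} :
    SetLike.IsHomogeneousElem (overGrading 𝒜 S) x ↔ IsHomFrac 𝒜 (x : FractionRing R) := by
  rw [isHomFrac_iff_exists_mem_fracGrading]
  rfl

theorem map_mem_overGrading (S : Subalgebra R (FractionRing R)) (n : ℤ) (a : R) (ha : a ∈ 𝒜 n) :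
    algebraMap R S a ∈ overGrading 𝒜 S n :=
  algebraMap_mem_fracGrading ha

theorem isGrRing_overGrading {S : Subalgebra R (FractionRing R)} (hS : IsGradedOverring 𝒜 S) :
    IsGrRing (overGrading 𝒜 S) where
  one_mem := by
    have := map_mem_overGrading (𝒜 := 𝒜) S 0 1 SetLike.GradedOne.one_mem
    simpa using this
  mul_mem ha hb := mul_mem_fracGrading ha hb
  internal := by
    classical
    constructor
    · rw [injective_iff_map_eq_zero]
      intro f hf
      rw [DirectSum.coeAddMonoidHom_eq_dfinsuppSum, DFinsupp.sum] at hf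
      have h := eq_zero_of_sum_fracGrading_eq_zero (𝒜 := 𝒜) f.support
        (fun i => ((f i : S) : FractionRing R)) (fun i => (f i).2) (by simpa using congrArg Subtype.val hf)
      ext i
      by_cases hi : i ∈ f.support
      · exact h i hi
      · simp [DFinsupp.notMem_support_iff.1 hi]
    · rintro ⟨x, hx⟩
      rw [← Set.mem_range, ← AddMonoidHom.coe_mrange, SetLike.mem_coe]
      have hx' := hS x hx
      induction hx' using AddSubmonoid.closure_induction with
      | mem y hy =>
        obtain ⟨hyS, hy⟩ := hy
        obtain ⟨n, hn⟩ := isHomFrac_iff_exists_mem_fracGrading.1 hy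
        exact ⟨DirectSum.of (fun i => overGrading 𝒜 S i) n ⟨⟨y, hyS⟩, hn⟩, by simp⟩
      | zero => exact zero_mem _
      | add y z hy hz ihy ihz =>
        have hle : AddSubmonoid.closure {y | y ∈ S ∧ IsHomFrac 𝒜 y} ≤
            S.toSubsemiring.toAddSubmonoid :=
          AddSubmonoid.closure_le.2 fun y hy => hy.1
        exact add_mem (ihy (hle hy)) (ihz (hle hz))

theorem isHomIdealOver_iff_isHomIdeal {S : Subalgebra R (FractionRing R)} {I : Ideal S} :
    IsHomIdealOver 𝒜 S I ↔ IsHomIdeal (overGrading 𝒜 S) I := by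
  have key : {y : FractionRing R | IsHomFrac 𝒜 y ∧ ∃ h : y ∈ S, (⟨y, h⟩ : S) ∈ I} =
      S.val.toAddMonoidHom '' {y : S | SetLike.IsHomogeneousElem (overGrading 𝒜 S) y ∧ y ∈ I} := by
    ext y
    simp only [isHomogeneousElem_overGrading]
    constructor
    · rintro ⟨hy, h, hI⟩
      exact ⟨⟨y, h⟩, ⟨hy, hI⟩, rfl⟩
    · rintro ⟨y, ⟨hy, hI⟩, rfl⟩
      exact ⟨hy, y.2, hI⟩
  refine forall₂_congr fun x _ => ?_
  rw [key, ← AddMonoidHom.map_mclosure]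
  exact AddSubmonoid.mem_map_iff_mem (f := S.val.toAddMonoidHom) Subtype.val_injective

theorem isGrMaxIdealOver_iff {S : Subalgebra R (FractionRing R)} {I : Ideal S} :
    IsGrMaxIdealOver 𝒜 S I ↔ IsGrMaxIdeal (overGrading 𝒜 S) I := by
  simp only [IsGrMaxIdealOver, IsGrMaxIdeal, isHomIdealOver_iff_isHomIdeal]

end HomogeneousFractions

section IntegralClosure

variable {R : Type*} [CommRing R] [IsDomain R] {𝒜 : ℤ → AddSubgroup R} [GradedRing 𝒜]

theorem exists_fracGradeHom_eq_of_isIntegral {x : FractionRing R} (hx : IsIntegral R x) :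
    ∃ f, fracGradeHom 𝒜 x = algebraMap (FractionRing R)[T;T⁻¹] _ f := by
  have h : IsIntegral (FractionRing R)[T;T⁻¹] (fracGradeHom 𝒜 x) :=
    hx.map_of_comp_eq (gradeHom 𝒜) (fracGradeHom 𝒜)
      (RingHom.ext fun r => (fracGradeHom_algebraMap 𝒜 r).symm)
  obtain ⟨f, hf⟩ := IsIntegrallyClosed.isIntegral_iff.1 h
  exact ⟨f, hf.symm⟩

theorem isIntegral_and_mem_fracGrading_of_top [IsNoetherianRing R] {x : FractionRing R}
    (hx : IsIntegral R x) {f : (FractionRing R)[T;T⁻¹]} (hf : fracGradeHom 𝒜 x = algebraMap _ _ f)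
    {N : ℤ} (hN : ∀ i, N < i → f.coeff i = 0) :
    IsIntegral R (f.coeff N) ∧ f.coeff N ∈ fracGrading 𝒜 N := by
  obtain ⟨r, hr, h⟩ := hx.isAlmostIntegral
  have hr0 : gradeHom 𝒜 r ≠ 0 := by
    simpa using (gradeHom_injective 𝒜).ne (nonZeroDivisors.ne_zero hr)
  obtain ⟨M, hM0, hM⟩ := LaurentPolynomial.exists_top hr0
  have key : ∀ n : ℕ, ∃ a ∈ 𝒜 (M + n * N), algebraMap R (FractionRing R) a =
      (gradeHom 𝒜 r).coeff M * f.coeff N ^ n := by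
    intro n
    obtain ⟨a, ha⟩ := h n
    have h1 : gradeHom 𝒜 a = gradeHom 𝒜 r * f ^ n := by
      apply IsFractionRing.injective (FractionRing R)[T;T⁻¹]
        (FractionRing (FractionRing R)[T;T⁻¹])
      rw [← fracGradeHom_algebraMap, ha, Algebra.smul_def, map_mul, map_mul, map_pow, map_pow,
        ← hf, fracGradeHom_algebraMap]
    obtain ⟨h2, h3⟩ := LaurentPolynomial.coeff_pow_of_top hN n
    refine ⟨decompose 𝒜 a (M + n * N), SetLike.coe_mem _, ?_⟩
    rw [← coeff_gradeHom, h1, LaurentPolynomial.coeff_mul_add_of_top hM h2, h3]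
  rw [coeff_gradeHom] at hM0 key
  refine ⟨IsAlmostIntegral.isIntegral ⟨decompose 𝒜 r M, ?_, fun n => ?_⟩, ?_⟩
  · exact mem_nonZeroDivisors_of_ne_zero fun h => hM0 (by rw [h, map_zero])
  · obtain ⟨a, -, ha⟩ := key n
    exact ⟨a, by rw [ha, Algebra.smul_def]⟩
  · obtain ⟨a, ha, ha'⟩ := key 1
    refine mem_fracGrading_of_mul_mem (algebraMap_mem_fracGrading (SetLike.coe_mem _)) hM0 ?_
    rw [pow_one, mul_comm] at ha'
    rw [← ha', add_comm]
    simpa using algebraMap_mem_fracGrading ha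

/-- The integral closure of a `ℤ`-graded Noetherian domain is a graded overring. -/
theorem isGradedOverring_integralClosure [IsNoetherianRing R] :
    IsGradedOverring 𝒜 (integralClosure R (FractionRing R)) := by
  suffices H : ∀ (k : ℕ) (f : (FractionRing R)[T;T⁻¹]) (x : FractionRing R),
      f.coeff.support.card = k → IsIntegral R x → fracGradeHom 𝒜 x = algebraMap _ _ f →
      x ∈ AddSubmonoid.closure {y | y ∈ integralClosure R (FractionRing R) ∧ IsHomFrac 𝒜 y} by
    intro x hx
    obtain ⟨f, hf⟩ := exists_fracGradeHom_eq_of_isIntegral (𝒜 := 𝒜) hx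
    exact H _ f x rfl hx hf
  intro k
  induction k using Nat.strong_induction_on with
  | _ k ih =>
    intro f x hk hx hf
    by_cases hf0 : f = 0
    · rw [hf0, map_zero, map_eq_zero] at hf
      rw [hf]
      exact zero_mem _
    obtain ⟨N, hN0, hN⟩ := LaurentPolynomial.exists_top hf0
    obtain ⟨hint, hmem⟩ := isIntegral_and_mem_fracGrading_of_top hx hf hN
    have hcoeff : (f - .single N (f.coeff N)).coeff = f.coeff.erase N := by
      rw [AddMonoidAlgebra.coeff_sub, AddMonoidAlgebra.coeff_single, Finsupp.erase_eq_sub_single]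
    rw [← sub_add_cancel x (f.coeff N)]
    refine add_mem (ih _ ?_ (f - .single N (f.coeff N)) _ rfl (hx.sub hint) ?_)
      (AddSubmonoid.subset_closure ⟨hint, isHomFrac_iff_exists_mem_fracGrading.2 ⟨N, hmem⟩⟩)
    · rw [hcoeff, Finsupp.support_erase, ← hk]
      exact Finset.card_erase_lt_of_mem (Finsupp.mem_support_iff.2 hN0)
    · rw [map_sub, map_sub, hf, mem_fracGrading.1 hmem]

end IntegralClosure

section HeightOne

variable {R : Type*} [CommRing R]

/-- A nonzero integral element `a` that is not a unit of `R[a]` lies in a height-one prime of the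
integral closure. -/
theorem exists_heightOnePrime_integralClosure [IsDomain R] [IsNoetherianRing R] {a : FractionRing R}
    (ha : IsIntegral R a) (ha0 : a ≠ 0)
    (hu : ¬ IsUnit (⟨a, Algebra.self_mem_adjoin_singleton R a⟩ : Algebra.adjoin R {a})) :
    ∃ Q : Ideal (integralClosure R (FractionRing R)), HeightOnePrime Q ∧ ⟨a, ha⟩ ∈ Q := by
  let A := Algebra.adjoin R {a}
  let B := integralClosure R (FractionRing R)
  let a' : A := ⟨a, Algebra.self_mem_adjoin_singleton R a⟩
  have hAB : A ≤ B := Algebra.adjoin_le (Set.singleton_subset_iff.2 ha)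
  have : Algebra.FiniteType R A :=
    (Subalgebra.fg_iff_finiteType _).1 ⟨{a}, by simp [A]⟩
  have : IsNoetherianRing A := Algebra.FiniteType.isNoetherianRing R A
  let : Algebra A B := (Subalgebra.inclusion hAB).toAlgebra
  have : IsScalarTower R A B := .of_algebraMap_eq fun _ => rfl
  have : Algebra.IsIntegral R B := inferInstanceAs (Algebra.IsIntegral R (integralClosure R _))
  have : Algebra.IsIntegral A B := .tower_top R
  have hinj : Function.Injective (algebraMap A B) := Subalgebra.inclusion_injective hAB
  obtain ⟨q, hq⟩ := Ideal.nonempty_minimalPrimes (I := Ideal.span {a'})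
    (by rwa [Ne, Ideal.span_singleton_eq_top])
  have hqp : q.IsPrime := hq.1.1
  have haq : a' ∈ q := hq.1.2 (Ideal.mem_span_singleton_self a')
  have hheight := Ideal.height_le_one_of_isPrincipal_of_mem_minimalPrimes _ q hq
  obtain ⟨Q, -, hQ, hQq⟩ := Ideal.exists_ideal_over_prime_of_isIntegral q (⊥ : Ideal B)
    (by rw [← RingHom.ker_eq_comap_bot, (RingHom.injective_iff_ker_eq_bot _).1 hinj]; exact bot_le)
  have haQ : (⟨a, ha⟩ : B) ∈ Q := by
    have : a' ∈ Q.comap (algebraMap A B) := hQq ▸ haq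
    exact this
  refine ⟨Q, ⟨hQ, ?_, fun P hP hPQ => ?_⟩, haQ⟩
  · rintro rfl
    exact ha0 (congrArg Subtype.val ((Ideal.mem_bot).1 haQ))
  · have hlt : P.comap (algebraMap A B) < q := hQq ▸ Ideal.IsIntegral.comap_lt_comap hPQ
    refine Ideal.eq_bot_of_comap_eq_bot (R := A) ?_
    by_contra hne
    have h1 := (Ideal.height_add_one_le_of_lt_of_isPrime hlt).trans hheight
    have h2 : (P.comap (algebraMap A B)).height ≤ 0 := by
      rwa [← ENat.add_le_add_iff_right ENat.one_ne_top, zero_add]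
    exact hne (Ideal.height_eq_zero_iff_eq_bot.1 (nonpos_iff_eq_zero.1 h2))

theorem exists_of_mem_homLocR {𝒜 : ℤ → AddSubgroup R} [GradedRing 𝒜] {P : Ideal R}
    (hP : P.IsPrime) {x : FractionRing R} (hx : x ∈ HomLocR 𝒜 P) :
    ∃ a w : R, SetLike.IsHomogeneousElem 𝒜 w ∧ w ∉ P ∧
      x * algebraMap R (FractionRing R) w = algebraMap R (FractionRing R) a := by
  induction hx using Algebra.adjoin_induction with
  | mem x hx => exact hx
  | algebraMap r =>
    exact ⟨r, 1, SetLike.isHomogeneousElem_one 𝒜, hP.one_notMem, by simp⟩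
  | add x y _ _ hx hy =>
    obtain ⟨a, v, hv, hvP, hx⟩ := hx
    obtain ⟨b, w, hw, hwP, hy⟩ := hy
    refine ⟨a * w + b * v, v * w, hv.mul hw, hP.mul_notMem hvP hwP, ?_⟩
    simp only [map_add, map_mul, ← hx, ← hy]
    ring
  | mul x y _ _ hx hy =>
    obtain ⟨a, v, hv, hvP, hx⟩ := hx
    obtain ⟨b, w, hw, hwP, hy⟩ := hy
    refine ⟨a * b, v * w, hv.mul hw, hP.mul_notMem hvP hwP, ?_⟩
    simp only [map_mul, ← hx, ← hy]
    ring

end HeightOne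

section GrLocal

variable {R : Type*} [CommRing R] {𝒜 : ℤ → AddSubgroup R}

theorem GrLocal.exists_isGrMaxIdeal (hloc : GrLocal 𝒜) :
    ∃ m, IsGrMaxIdeal 𝒜 m ∧ ∀ I, IsHomIdeal 𝒜 I → I ≠ ⊤ → I ≤ m := by
  obtain ⟨m, hm, huniq⟩ := hloc
  refine ⟨m, hm, fun I hI hne => ?_⟩
  obtain ⟨M, hM, hIM⟩ := exists_isGrMaxIdeal_ge hI hne
  exact huniq M hM ▸ hIM

theorem isHomIdeal_bot : IsHomIdeal 𝒜 (⊥ : Ideal R) := fun x hx => by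
  rw [Ideal.mem_bot.1 hx]
  exact zero_mem _

/-- A prime of height one containing a nonzero homogeneous element is homogeneous. -/
theorem HeightOnePrime.isHomIdeal (h𝒜 : IsGrRing 𝒜) {Q : Ideal R} (hQ : HeightOnePrime Q) {a : R}
    (ha : SetLike.IsHomogeneousElem 𝒜 a) (ha0 : a ≠ 0) (haQ : a ∈ Q) : IsHomIdeal 𝒜 Q := by
  let := h𝒜.gradedRing
  obtain ⟨P, hP, hPhom, hPQ, hmax⟩ := h𝒜.exists_homogeneous_prime_le hQ.1
  have haP : a ∈ P := hmax (Ideal.span {a})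
    (isHomIdeal_iff_isHomogeneous.2 (Ideal.homogeneous_span 𝒜 {a} (by simpa using ha)))
    ((Ideal.span_singleton_le_iff_mem Q).2 haQ) (Ideal.mem_span_singleton_self a)
  rcases hPQ.eq_or_lt with rfl | hlt
  · exact hPhom
  · rw [hQ.2.2 P hP hlt] at haP
    exact absurd haP ha0

/-- In a graded integral extension of a gr-local ring, the graded maximal ideals lie over the
graded maximal ideal. -/
theorem IsGrMaxIdeal.comap_eq {T : Type*} [CommRing T] [Algebra R T] [Algebra.IsIntegral R T]
    {ℬ : ℤ → AddSubgroup T} (h𝒜 : IsGrRing 𝒜) (hℬ : IsGrRing ℬ)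
    (hmap : ∀ i, ∀ a ∈ 𝒜 i, algebraMap R T a ∈ ℬ i) {m : Ideal R} (hm : IsGrMaxIdeal 𝒜 m)
    (hle : ∀ I, IsHomIdeal 𝒜 I → I ≠ ⊤ → I ≤ m) {N : Ideal T} (hN : IsGrMaxIdeal ℬ N) :
    N.comap (algebraMap R T) = m := by
  have : m.IsPrime := IsGrMaxIdeal.isPrime h𝒜 hm
  have : N.IsPrime := IsGrMaxIdeal.isPrime hℬ hN
  have hNm : N.comap (algebraMap R T) ≤ m :=
    hle _ (IsHomIdeal.comap h𝒜 hℬ hmap hN.1) (Ideal.comap_ne_top _ hN.2.1)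
  refine le_antisymm hNm ?_
  obtain ⟨N', hNN', hN', hN'm⟩ := Ideal.exists_ideal_over_prime_of_isIntegral_of_isPrime m N hNm
  have hmN' : m.map (algebraMap R T) ≤ N' := Ideal.map_le_iff_le_comap.2 hN'm.ge
  have hJ := hN.2.2 (N ⊔ m.map (algebraMap R T))
    (IsHomIdeal.sup hN.1 (IsHomIdeal.map h𝒜 hℬ hmap hm.1)) le_sup_left
    fun h => hN'.ne_top (top_le_iff.1 (h ▸ sup_le hNN' hmN'))
  exact Ideal.map_le_iff_le_comap.1 (le_sup_right.trans hJ.le)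

end GrLocal

/-- Let `(R, 𝔪)` be a gr-local `ℤ`-graded Noetherian gr-(R₁) domain such
that height-one homogeneous primes of the integral closure `R′` contract to height-one
homogeneous primes of `R`.  Let `S` be a graded overring of `R` that is integral over `R` and
satisfies graded going-down over `R`.  Then `S` is gr-local. -/
theorem grLocalOver_of_integral_ggd
    {R : Type*} [CommRing R] [IsDomain R] [IsNoetherianRing R]
    (𝒜 : ℤ → AddSubgroup R) (hGr : IsGrRing 𝒜)
    (hloc : GrLocal 𝒜) (hR1 : GrR1 𝒜)
    (hcontr : ∀ P : Ideal (integralClosure R (FractionRing R)),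
      HeightOnePrime P → IsHomIdealOver 𝒜 (integralClosure R (FractionRing R)) P →
      HeightOnePrime (P.comap (algebraMap R (integralClosure R (FractionRing R)))) ∧
      IsHomIdeal 𝒜 (P.comap (algebraMap R (integralClosure R (FractionRing R)))))
    (S : Subalgebra R (FractionRing R)) (hS : IsGradedOverring 𝒜 S)
    (hint : ∀ s : S, IsIntegral R s) (hggd : GGD 𝒜 S) :
    GrLocalOver 𝒜 S := by
  let := hGr.gradedRing
  have hSGr := isGrRing_overGrading hS
  have : Algebra.IsIntegral R S := ⟨hint⟩
  obtain ⟨m, hm, hle⟩ := hloc.exists_isGrMaxIdeal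
  have hmp := IsGrMaxIdeal.isPrime hGr hm
  suffices H : ∀ N₁ N₂ : Ideal S, IsGrMaxIdeal (overGrading 𝒜 S) N₁ →
      IsGrMaxIdeal (overGrading 𝒜 S) N₂ → N₁ ≤ N₂ by
    obtain ⟨M, hM, -⟩ := exists_isGrMaxIdeal_ge
      (isHomIdeal_bot (𝒜 := overGrading 𝒜 S)) bot_ne_top
    refine ⟨M, isGrMaxIdealOver_iff.2 hM, fun N hN => ?_⟩
    replace hN := isGrMaxIdealOver_iff.1 hN
    exact le_antisymm (H N M hN hM) (H M N hM hN)
  intro N₁ N₂ hN₁ hN₂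
  suffices H : ∀ a : S, SetLike.IsHomogeneousElem (overGrading 𝒜 S) a → a ∈ N₁ → a ∈ N₂ from
    fun x hx => (AddSubmonoid.closure_le (S := N₂.toAddSubmonoid)).2 (fun y hy => H y hy.1 hy.2)
      (hN₁.1 x hx)
  intro a hahom haN₁
  by_contra haN₂
  have ha0 : (a : FractionRing R) ≠ 0 := fun h => haN₂ ((Subtype.ext h : a = 0) ▸ N₂.zero_mem)
  have haint : IsIntegral R (a : FractionRing R) := (hint a).map S.val
  have hAS : Algebra.adjoin R {(a : FractionRing R)} ≤ S :=
    Algebra.adjoin_le (Set.singleton_subset_iff.2 a.2)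
  obtain ⟨Q, hQ, haQ⟩ := exists_heightOnePrime_integralClosure haint ha0 fun hu =>
    hN₁.2.1 (Ideal.eq_top_of_isUnit_mem _ haN₁ (hu.map (Subalgebra.inclusion hAS)))
  have hafrac : IsHomFrac 𝒜 (a : FractionRing R) := isHomogeneousElem_overGrading.1 hahom
  have hQhom := hQ.isHomIdeal (isGrRing_overGrading (𝒜 := 𝒜) isGradedOverring_integralClosure)
    (isHomogeneousElem_overGrading.2 hafrac) (fun h => ha0 (congrArg Subtype.val h)) haQ
  obtain ⟨hp, hphom⟩ := hcontr Q hQ (isHomIdealOver_iff_isHomIdeal.2 hQhom)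
  have hval := hR1 _ hp hphom a ha0 hafrac
  obtain ⟨P, hP, -, hPN₂, hPp⟩ := hggd _ m N₂ hp.1 hmp (IsGrMaxIdeal.isPrime hSGr hN₂) hphom hm.1
    (isHomIdealOver_iff_isHomIdeal.2 hN₂.1) (hle _ hphom hp.1.ne_top)
    (IsGrMaxIdeal.comap_eq hGr hSGr (map_mem_overGrading S) hm hle hN₂)
  have hmem : ∀ r w : R, a * algebraMap R (FractionRing R) w = algebraMap R (FractionRing R) r →
      r ∈ Q.comap (algebraMap R (integralClosure R (FractionRing R))) := fun r w h => by
    have := Q.mul_mem_right (algebraMap R _ w) haQ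
    rwa [show _ * _ = algebraMap R (integralClosure R (FractionRing R)) r from Subtype.ext h]
      at this
  rcases hval with hval | hval <;> obtain ⟨r, w, -, hw, h⟩ := exists_of_mem_homLocR hp.1 hval
  · have hr := hmem r w h
    rw [← hPp, Ideal.mem_comap] at hr hw
    rw [← (Subtype.ext h : a * algebraMap R S w = algebraMap R S r)] at hr
    exact haN₂ (hPN₂ ((hP.mem_or_mem hr).resolve_right hw))
  · exact hw (hmem w r (by rw [← h, mul_inv_cancel_left₀ ha0]))
end

section
/- Let R be a gr-essential G-graded domain. If S is a graded overring of R such that for each homogeneous prime P of R there exists a homogeneous prime Q of S with Q ∩ R = P, then S = R. -/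
section HomogeneousLocalization

variable {ι : Type*} [DecidableEq ι] {R : Type*} [CommRing R]

/-- In a domain graded by a group, a homogeneous multiple of `a` by a nonzero homogeneous
element forces `a` to be homogeneous. -/
theorem IsGrRing.isHomogeneousElem_of_mul_mem [AddCommGroup ι] [IsDomain R]
    {𝒜 : ι → AddSubgroup R}
    (hGr : IsGrRing 𝒜) {c a : R} {i k : ι} (hc : c ∈ 𝒜 i) (hc0 : c ≠ 0) (hca : c * a ∈ 𝒜 k) :
    SetLike.IsHomogeneousElem 𝒜 a := by
  let : SetLike.GradedMonoid 𝒜 :=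
    { one_mem := hGr.one_mem, mul_mem := fun _ _ _ _ h₁ h₂ => hGr.mul_mem h₁ h₂ }
  let : DirectSum.Decomposition 𝒜 := hGr.internal.chooseDecomposition
  let : GradedRing 𝒜 := {}
  have hmul := DirectSum.coe_decompose_mul_add_of_left_mem 𝒜 (j := k - i) (b := a) hc
  rw [add_sub_cancel, DirectSum.decompose_of_mem_same 𝒜 hca] at hmul
  exact ⟨k - i, mul_left_cancel₀ hc0 hmul ▸ SetLike.coe_mem _⟩

/-- Every element of the homogeneous localization at a prime is a fraction whose denominator is
homogeneous and outside the prime. -/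
theorem exists_mul_eq_of_mem_homLocR [AddCommMonoid ι] {𝒜 : ι → AddSubgroup R}
    (hGr : IsGrRing 𝒜) {P : Ideal R} (hP : P.IsPrime) {x : FractionRing R}
    (hx : x ∈ HomLocR 𝒜 P) :
    ∃ a w : R, SetLike.IsHomogeneousElem 𝒜 w ∧ w ∉ P ∧
      x * algebraMap R (FractionRing R) w = algebraMap R (FractionRing R) a := by
  have homogeneous_mul {v w : R} (hv : SetLike.IsHomogeneousElem 𝒜 v)
      (hw : SetLike.IsHomogeneousElem 𝒜 w) : SetLike.IsHomogeneousElem 𝒜 (v * w) := by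
    obtain ⟨i, hi⟩ := hv
    obtain ⟨j, hj⟩ := hw
    exact ⟨i + j, hGr.mul_mem hi hj⟩
  induction hx using Algebra.adjoin_induction with
  | mem x hx => exact hx
  | algebraMap r =>
    exact ⟨r, 1, ⟨0, hGr.one_mem⟩, (Ideal.ne_top_iff_one P).mp hP.ne_top, by simp⟩
  | add x y _ _ hx hy =>
    obtain ⟨a, v, hv, hvP, hav⟩ := hx
    obtain ⟨b, w, hw, hwP, hbw⟩ := hy
    refine ⟨a * w + b * v, v * w, homogeneous_mul hv hw, hP.mul_notMem hvP hwP, ?_⟩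
    simp only [map_mul, map_add, ← hav, ← hbw]
    ring
  | mul x y _ _ hx hy =>
    obtain ⟨a, v, hv, hvP, hav⟩ := hx
    obtain ⟨b, w, hw, hwP, hbw⟩ := hy
    refine ⟨a * b, v * w, homogeneous_mul hv hw, hP.mul_notMem hvP hwP, ?_⟩
    simp only [map_mul, ← hav, ← hbw]
    ring

/-- If a prime `P` whose homogeneous localization is a gr-valuation domain is contracted from an
overring `S`, then every homogeneous element of `S` lies in that localization. -/
theorem mem_homLocR_of_comap_eq [AddCommGroup ι] [IsDomain R]
    {𝒜 : ι → AddSubgroup R} (hGr : IsGrRing 𝒜)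
    {P : Ideal R} (hP : P.IsPrime) (hval : GrValuation 𝒜 (HomLocR 𝒜 P))
    {S : Subalgebra R (FractionRing R)} {Q : Ideal S} (hQ : Q.comap (algebraMap R S) = P)
    {s : FractionRing R} (hs : s ∈ S) (hhom : IsHomFrac 𝒜 s) : s ∈ HomLocR 𝒜 P := by
  rcases eq_or_ne s 0 with rfl | hs0
  · exact zero_mem _
  refine (hval s hs0 hhom).elim id fun hinv => ?_
  obtain ⟨a, w, ⟨k, hk⟩, hwP, haw⟩ := exists_mul_eq_of_mem_homLocR hGr hP hinv
  have hsa : s * algebraMap R (FractionRing R) a = algebraMap R (FractionRing R) w := by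
    rw [← haw, mul_inv_cancel_left₀ hs0]
  have haP : a ∉ P := by
    intro ha
    rw [← hQ, Ideal.mem_comap] at ha
    apply hwP
    rw [← hQ, Ideal.mem_comap]
    have heq : algebraMap R S w = ⟨s, hs⟩ * algebraMap R S a := Subtype.ext hsa.symm
    exact heq ▸ Q.mul_mem_left _ ha
  obtain ⟨i, j, c, b, hc, hb, hb0, hcb⟩ := hhom
  have hinj := FaithfulSMul.algebraMap_injective R (FractionRing R)
  have hc0 : c ≠ 0 := by
    rintro rfl
    rw [map_zero] at hcb
    exact mul_ne_zero hs0 ((map_ne_zero_iff _ hinj).mpr hb0) hcb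
  have hca : c * a = w * b := by
    apply hinj
    rw [map_mul, map_mul, ← hcb, ← hsa]
    ring
  exact Algebra.subset_adjoin
    ⟨w, a, hGr.isHomogeneousElem_of_mul_mem hc hc0 (hca ▸ hGr.mul_mem hk hb), haP, hsa⟩

end HomogeneousLocalization

/-- Let `R` be a gr-essential `G`-graded domain. If `S` is a graded overring
of `R` such that every homogeneous prime of `R` is the contraction of a homogeneous prime of
`S`, then `S = R`. -/
theorem eq_bot_of_grEssential_of_liesOver
    {G : Type*} [DecidableEq G] [AddCommGroup G] (hG : ∀ g : G, g ≠ 0 → ¬IsOfFinAddOrder g)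
    {R : Type*} [CommRing R] [IsDomain R]
    (𝒜 : G → AddSubgroup R) (hGr : IsGrRing 𝒜)
    (hess : GrEssential 𝒜)
    (S : Subalgebra R (FractionRing R)) (hS : IsGradedOverring 𝒜 S)
    (hlies : ∀ P : Ideal R, P.IsPrime → IsHomIdeal 𝒜 P →
      ∃ Q : Ideal S, Q.IsPrime ∧ IsHomIdealOver 𝒜 S Q ∧
        Q.comap (algebraMap R S) = P) :
    S = ⊥ := by
  obtain ⟨I, hI, hbot⟩ := hess
  refine eq_bot_iff.mpr fun x hx => ?_
  rw [← SetLike.mem_coe, hbot, Set.mem_iInter₂]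
  intro P hPI
  obtain ⟨hP, hPhom, hval⟩ := hI P hPI
  obtain ⟨Q, -, -, hQ⟩ := hlies P hP hPhom
  refine (AddSubmonoid.closure_le (S := (HomLocR 𝒜 P).toSubsemiring.toAddSubmonoid)).mpr ?_
    (hS x hx)
  exact fun y hy => mem_homLocR_of_comap_eq hGr hP hval hQ hy.1 hy.2
end

section
/- Every graded P-domain is a graded perinormal domain. -/
/-- A graded `P`-domain: a gr-essential domain all of whose localizations at multiplicative
sets of (nonzero) homogeneous elements are gr-essential. -/
def GradedPDomain {ι : Type*} [DecidableEq ι] [AddCommMonoid ι]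
    {R : Type*} [CommRing R] [IsDomain R] (𝒜 : ι → AddSubgroup R) : Prop :=
  GrEssential 𝒜 ∧
    ∀ W : Submonoid R, (∀ w ∈ W, w ≠ 0 ∧ SetLike.IsHomogeneousElem 𝒜 w) →
      GrEssentialSub 𝒜 (LocW W)

section GradedRings

open DirectSum

/-- A torsion-free abelian group has unique sums. -/
theorem uniqueSums_of_isAddTorsionFree (G : Type*) [AddCommGroup G] [IsAddTorsionFree G] :
    UniqueSums G :=
  have : TwoUniqueSums G := TwoUniqueSums.of_injective_addHom
    (DivisibleHull.coeAddMonoidHom G).toAddHom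
    DivisibleHull.coe_injective inferInstance
  inferInstance

variable {ι : Type*} [DecidableEq ι] {A : Type*} [CommRing A]

theorem isHomogeneous_iff_mem_closure [AddMonoid ι] (ℬ : ι → AddSubgroup A) [GradedRing ℬ]
    (I : Ideal A) :
    I.IsHomogeneous ℬ ↔
      ∀ x ∈ I, x ∈ AddSubmonoid.closure {y : A | SetLike.IsHomogeneousElem ℬ y ∧ y ∈ I} := by
  classical
  constructor
  · intro h x hx
    rw [← sum_support_decompose ℬ x]
    exact sum_mem fun i _ => AddSubmonoid.subset_closure ⟨⟨i, SetLike.coe_mem _⟩, h i hx⟩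
  · intro h i x hx
    replace h := h x hx
    clear hx
    induction h using AddSubmonoid.closure_induction with
    | mem y hy =>
      obtain ⟨⟨j, hj⟩, hyI⟩ := hy
      by_cases hij : j = i
      · subst hij
        rwa [decompose_of_mem_same ℬ hj]
      · rw [decompose_of_mem_ne ℬ hj hij]
        exact I.zero_mem
    | zero => simp
    | add y z _ _ hy hz =>
      rw [decompose_add, DirectSum.add_apply, AddSubgroup.coe_add]
      exact I.add_mem hy hz

/-- In a ring graded by a commutative monoid with unique sums, a proper homogeneous ideal is
prime as soon as it satisfies the primality condition on homogeneous elements. -/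
theorem isPrime_of_uniqueSums [AddCommMonoid ι] [UniqueSums ι] (ℬ : ι → AddSubgroup A)
    [GradedRing ℬ] {I : Ideal A} (hI : I.IsHomogeneous ℬ) (hne : I ≠ ⊤)
    (hmul : ∀ x y, SetLike.IsHomogeneousElem ℬ x → SetLike.IsHomogeneousElem ℬ y →
      x * y ∈ I → x ∈ I ∨ y ∈ I) : I.IsPrime := by
  classical
  refine ⟨hne, fun {x y} hxy => ?_⟩
  by_contra! hcon
  have key : ∀ z ∉ I, ∃ s : Finset ι, s.Nonempty ∧ (∀ i ∈ s, (decompose ℬ z i : A) ∉ I) ∧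
      z - ∑ i ∈ s, (decompose ℬ z i : A) ∈ I := by
    intro z hz
    have hsub : z - ∑ i ∈ (decompose ℬ z).support.filter (fun i => (decompose ℬ z i : A) ∉ I),
        (decompose ℬ z i : A) ∈ I := by
      nth_rewrite 1 [← sum_support_decompose ℬ z]
      rw [← Finset.sum_filter_add_sum_filter_not _ (fun i => (decompose ℬ z i : A) ∉ I),
        add_sub_cancel_left]
      exact sum_mem fun i hi => by simpa using (Finset.mem_filter.1 hi).2
    refine ⟨_, ?_, fun i hi => (Finset.mem_filter.1 hi).2, hsub⟩
    by_contra hemp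
    rw [Finset.not_nonempty_iff_eq_empty.1 hemp] at hsub
    exact hz (by simpa using hsub)
  obtain ⟨s, hs, hsI, hxs⟩ := key x hcon.1
  obtain ⟨t, ht, htI, hyt⟩ := key y hcon.2
  obtain ⟨a, ha, b, hb, hab⟩ := UniqueSums.uniqueAdd_of_nonempty hs ht
  have hprod : (∑ i ∈ s, (decompose ℬ x i : A)) * ∑ j ∈ t, (decompose ℬ y j : A) ∈ I := by
    have h := I.sub_mem (I.sub_mem hxy (I.mul_mem_right y hxs))
      (I.mul_mem_left (∑ i ∈ s, (decompose ℬ x i : A)) hyt)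
    convert h using 1
    ring
  have hcomp := hI (a + b) hprod
  have hval : (decompose ℬ ((∑ i ∈ s, (decompose ℬ x i : A)) *
      ∑ j ∈ t, (decompose ℬ y j : A)) (a + b) : A) =
      (decompose ℬ x a : A) * (decompose ℬ y b : A) := by
    have hmem (i j : ι) : (decompose ℬ x i : A) * (decompose ℬ y j : A) ∈ ℬ (i + j) :=
      SetLike.GradedMul.mul_mem (SetLike.coe_mem _) (SetLike.coe_mem _)
    rw [Finset.sum_mul_sum, ← Finset.sum_product', decompose_sum, DFinsupp.finsetSum_apply,
      AddSubgroup.val_finsetSum, Finset.sum_eq_single (a, b)]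
    · exact decompose_of_mem_same ℬ (hmem a b)
    · rintro ⟨i, j⟩ hij hne'
      refine decompose_of_mem_ne ℬ (hmem i j) fun h => hne' ?_
      obtain ⟨rfl, rfl⟩ := hab (Finset.mem_product.1 hij).1 (Finset.mem_product.1 hij).2 h
      rfl
    · exact fun h => (h (Finset.mem_product.2 ⟨ha, hb⟩)).elim
  rw [hval] at hcomp
  exact (hmul _ _ ⟨a, SetLike.coe_mem _⟩ ⟨b, SetLike.coe_mem _⟩ hcomp).elim (hsI a ha) (htI b hb)

/-- Every proper homogeneous ideal is contained in a maximal proper homogeneous ideal. -/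
theorem exists_le_maximal_isHomogeneous [AddMonoid ι] (ℬ : ι → AddSubgroup A) [GradedRing ℬ]
    {I : Ideal A} (hI : I.IsHomogeneous ℬ) (hne : I ≠ ⊤) :
    ∃ M, I ≤ M ∧ Maximal (fun J : Ideal A => J.IsHomogeneous ℬ ∧ J ≠ ⊤) M := by
  refine zorn_le_nonempty₀ {J : Ideal A | J.IsHomogeneous ℬ ∧ J ≠ ⊤} ?_ I ⟨hI, hne⟩
  intro c hc hchain J hJ
  refine ⟨sSup c, ⟨Ideal.IsHomogeneous.sSup fun K hK => (hc hK).1, ?_⟩, fun K hK => le_sSup hK⟩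
  rw [Ideal.ne_top_iff_one, Submodule.mem_sSup_of_directed ⟨J, hJ⟩ hchain.directedOn]
  rintro ⟨K, hK, h1⟩
  exact (hc hK).2 ((Ideal.eq_top_iff_one K).2 h1)

/-- A maximal proper homogeneous ideal is prime if the degrees have unique sums. -/
theorem isPrime_of_maximal_isHomogeneous [AddCommMonoid ι] [UniqueSums ι]
    (ℬ : ι → AddSubgroup A) [GradedRing ℬ] {M : Ideal A}
    (hM : Maximal (fun J : Ideal A => J.IsHomogeneous ℬ ∧ J ≠ ⊤) M) : M.IsPrime := by
  refine isPrime_of_uniqueSums ℬ hM.prop.1 hM.prop.2 fun x y hx _ hxy => ?_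
  by_contra! hcon
  have htop : M ⊔ Ideal.span {x} = ⊤ := by
    by_contra hne
    have hhom : (M ⊔ Ideal.span {x}).IsHomogeneous ℬ :=
      hM.prop.1.sup (Ideal.homogeneous_span ℬ {x} (by simpa using hx))
    exact hcon.1 (hM.le_of_ge ⟨hhom, hne⟩ le_sup_left
      (Ideal.mem_sup_right (Ideal.mem_span_singleton_self x)))
  obtain ⟨m, hm, z, hz, hmz⟩ := Submodule.mem_sup.1 ((Ideal.eq_top_iff_one _).1 htop)
  obtain ⟨r, rfl⟩ := Ideal.mem_span_singleton'.1 hz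
  apply hcon.2
  have : y = m * y + r * (x * y) := by rw [← mul_assoc, ← add_mul, hmz, one_mul]
  rw [this]
  exact M.add_mem (M.mul_mem_right y hm) (M.mul_mem_left r hxy)

/-- Homogeneous elements outside the unique maximal homogeneous ideal are units. -/
theorem isUnit_of_notMem_unique_maximal [AddMonoid ι] (ℬ : ι → AddSubgroup A) [GradedRing ℬ]
    {M : Ideal A}
    (huniq : ∀ N, Maximal (fun J : Ideal A => J.IsHomogeneous ℬ ∧ J ≠ ⊤) N → N = M)
    {x : A} (hx : SetLike.IsHomogeneousElem ℬ x) (hxM : x ∉ M) : IsUnit x := by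
  by_contra hunit
  obtain ⟨N, hN, hmax⟩ := exists_le_maximal_isHomogeneous ℬ
    (Ideal.homogeneous_span ℬ {x} (by simpa using hx))
    (mt Ideal.span_singleton_eq_top.1 hunit)
  exact hxM (huniq N hmax ▸ hN (Ideal.mem_span_singleton_self x))

/-- The contraction of a homogeneous ideal along a degree-preserving ring homomorphism is
homogeneous. -/
theorem isHomogeneous_comap [AddMonoid ι] {B : Type*} [CommRing B] (𝒜 : ι → AddSubgroup A)
    [GradedRing 𝒜] (ℬ : ι → AddSubgroup B) [GradedRing ℬ] (f : A →+* B)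
    (hf : ∀ i, ∀ a ∈ 𝒜 i, f a ∈ ℬ i) {I : Ideal B} (hI : I.IsHomogeneous ℬ) :
    (I.comap f).IsHomogeneous 𝒜 :=
  (HomogeneousIdeal.comap (⟨f, fun {i a} h => hf i a h⟩ : 𝒜 →+*ᵍ ℬ) ⟨I, hI⟩).isHomogeneous

end GradedRings

section Overrings

open DirectSum

variable {G : Type*} [AddCommGroup G] {R : Type*} [CommRing R]

theorem mem_locW_iff {W : Submonoid R} {x : FractionRing R} :
    x ∈ LocW W ↔ ∃ r : R, ∃ w ∈ W,
      x * algebraMap R (FractionRing R) w = algebraMap R (FractionRing R) r := by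
  refine ⟨fun hx => ?_, fun hx => Algebra.subset_adjoin hx⟩
  induction hx using Algebra.adjoin_induction with
  | mem x hx => exact hx
  | algebraMap r => exact ⟨r, 1, W.one_mem, by simp⟩
  | add x y _ _ hx hy =>
    obtain ⟨r, w, hw, hrw⟩ := hx
    obtain ⟨s, v, hv, hsv⟩ := hy
    refine ⟨r * v + s * w, w * v, W.mul_mem hw hv, ?_⟩
    rw [map_add, map_mul, map_mul, map_mul, ← hrw, ← hsv]
    ring
  | mul x y _ _ hx hy =>
    obtain ⟨r, w, hw, hrw⟩ := hx
    obtain ⟨s, v, hv, hsv⟩ := hy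
    refine ⟨r * s, w * v, W.mul_mem hw hv, ?_⟩
    rw [map_mul, map_mul, ← hrw, ← hsv]
    ring

variable [IsDomain R]

theorem isUnit_algebraMap_locW {W : Submonoid R} (hW : ∀ w ∈ W, w ≠ 0) {w : R} (hw : w ∈ W) :
    IsUnit (algebraMap R (LocW W) w) := by
  have hw0 : algebraMap R (FractionRing R) w ≠ 0 := by simpa using hW w hw
  refine IsUnit.of_mul_eq_one ⟨(algebraMap R (FractionRing R) w)⁻¹,
    mem_locW_iff.2 ⟨1, w, hw, by rw [inv_mul_cancel₀ hw0, map_one]⟩⟩ (Subtype.ext ?_)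
  exact mul_inv_cancel₀ hw0

/-- If `W` contains all homogeneous elements outside `P`, then the homogeneous primes of `R_W`
contract into `P`. -/
theorem comap_locW_le {ι : Type*} {𝒜 : ι → AddSubgroup R} {W : Submonoid R} (hW : ∀ w ∈ W, w ≠ 0) {P : Ideal R}
    (hP : ∀ w, SetLike.IsHomogeneousElem 𝒜 w → w ∉ P → w ∈ W) {Q : Ideal (LocW W)}
    (hQ : Q.IsPrime) (hQR : IsHomIdeal 𝒜 (Q.comap (algebraMap R (LocW W)))) :
    Q.comap (algebraMap R (LocW W)) ≤ P := by
  intro r hr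
  refine (AddSubmonoid.closure_le (S := P.toAddSubmonoid)).2 ?_ (hQR r hr)
  rintro y ⟨hyh, hyQ⟩
  by_contra hyP
  exact hQ.ne_top (Ideal.eq_top_of_isUnit_mem Q hyQ
    (isUnit_algebraMap_locW hW (hP y hyh hyP)))

theorem IsHomFrac.mul {𝒜 : G → AddSubgroup R} [SetLike.GradedMonoid 𝒜] {x y : FractionRing R}
    (hx : IsHomFrac 𝒜 x) (hy : IsHomFrac 𝒜 y) : IsHomFrac 𝒜 (x * y) := by
  obtain ⟨i, j, a, b, ha, hb, hb0, hab⟩ := hx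
  obtain ⟨k, l, c, d, hc, hd, hd0, hcd⟩ := hy
  refine ⟨i + k, j + l, a * c, b * d, SetLike.mul_mem_graded ha hc, SetLike.mul_mem_graded hb hd,
    mul_ne_zero hb0 hd0, ?_⟩
  rw [map_mul, map_mul, ← hab, ← hcd]
  ring

/-- The elements of degree `g` in the graded quotient field. -/
def fracComponent (𝒜 : G → AddSubgroup R) [SetLike.GradedMonoid 𝒜] (g : G) :
    AddSubgroup (FractionRing R) where
  carrier := {x | ∃ (j : G) (a b : R), a ∈ 𝒜 (g + j) ∧ b ∈ 𝒜 j ∧ b ≠ 0 ∧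
    x * algebraMap R (FractionRing R) b = algebraMap R (FractionRing R) a}
  zero_mem' := ⟨0, 0, 1, zero_mem _, SetLike.one_mem_graded 𝒜, one_ne_zero, by simp⟩
  add_mem' := by
    rintro x y ⟨j, a, b, ha, hb, hb0, hab⟩ ⟨l, c, d, hc, hd, hd0, hcd⟩
    refine ⟨j + l, a * d + c * b, b * d, add_mem ?_ ?_, SetLike.mul_mem_graded hb hd,
      mul_ne_zero hb0 hd0, ?_⟩
    · exact add_assoc g j l ▸ SetLike.mul_mem_graded ha hd
    · have h := SetLike.mul_mem_graded hc hb
      rwa [add_assoc, add_comm l j] at h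
    · rw [map_add, map_mul, map_mul, map_mul, ← hab, ← hcd]
      ring
  neg_mem' := by
    rintro x ⟨j, a, b, ha, hb, hb0, hab⟩
    exact ⟨j, -a, b, neg_mem ha, hb, hb0, by rw [map_neg, ← hab, neg_mul]⟩

variable {𝒜 : G → AddSubgroup R}

theorem isHomFrac_iff_exists_mem_fracComponent [SetLike.GradedMonoid 𝒜] {x : FractionRing R} :
    IsHomFrac 𝒜 x ↔ ∃ g, x ∈ fracComponent 𝒜 g := by
  constructor
  · rintro ⟨i, j, a, b, ha, hb, hb0, hab⟩
    exact ⟨i - j, j, a, b, (sub_add_cancel i j).symm ▸ ha, hb, hb0, hab⟩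
  · rintro ⟨g, j, a, b, ha, hb, hb0, hab⟩
    exact ⟨g + j, j, a, b, ha, hb, hb0, hab⟩

theorem algebraMap_mem_fracComponent [SetLike.GradedMonoid 𝒜] {g : G} {a : R} (ha : a ∈ 𝒜 g) :
    algebraMap R (FractionRing R) a ∈ fracComponent 𝒜 g :=
  ⟨0, a, 1, (add_zero g).symm ▸ ha, SetLike.one_mem_graded 𝒜, one_ne_zero, by simp⟩

theorem mul_mem_fracComponent [SetLike.GradedMonoid 𝒜] {g h : G} {x y : FractionRing R}
    (hx : x ∈ fracComponent 𝒜 g) (hy : y ∈ fracComponent 𝒜 h) :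
    x * y ∈ fracComponent 𝒜 (g + h) := by
  obtain ⟨j, a, b, ha, hb, hb0, hab⟩ := hx
  obtain ⟨l, c, d, hc, hd, hd0, hcd⟩ := hy
  refine ⟨j + l, a * c, b * d, ?_, SetLike.mul_mem_graded hb hd, mul_ne_zero hb0 hd0, ?_⟩
  · exact add_add_add_comm g h j l ▸ SetLike.mul_mem_graded ha hc
  · rw [map_mul, map_mul, ← hab, ← hcd]
    ring

/-- The homogeneous components of an overring. -/
def overringComponent (𝒜 : G → AddSubgroup R) [SetLike.GradedMonoid 𝒜]
    (S : Subalgebra R (FractionRing R)) (g : G) : AddSubgroup S :=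
  (fracComponent 𝒜 g).comap (S.val : S →+ FractionRing R)

theorem isHomogeneousElem_overringComponent_iff [SetLike.GradedMonoid 𝒜]
    {S : Subalgebra R (FractionRing R)} {x : S} :
    SetLike.IsHomogeneousElem (overringComponent 𝒜 S) x ↔ IsHomFrac 𝒜 (x : FractionRing R) :=
  isHomFrac_iff_exists_mem_fracComponent.symm

theorem algebraMap_mem_overringComponent [SetLike.GradedMonoid 𝒜]
    (S : Subalgebra R (FractionRing R)) (g : G) (a : R) (ha : a ∈ 𝒜 g) :
    algebraMap R S a ∈ overringComponent 𝒜 S g :=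
  algebraMap_mem_fracComponent ha

variable [DecidableEq G]

/-- Finitely many homogeneous fractions have a common homogeneous denominator. -/
theorem exists_common_denominator [SetLike.GradedMonoid 𝒜] (s : Finset G)
    (f : G → FractionRing R) (hf : ∀ g ∈ s, f g ∈ fracComponent 𝒜 g) :
    ∃ (k : G) (c : R), c ∈ 𝒜 k ∧ c ≠ 0 ∧ ∀ g ∈ s, ∃ r ∈ 𝒜 (g + k),
      f g * algebraMap R (FractionRing R) c = algebraMap R (FractionRing R) r := by
  induction s using Finset.induction_on with
  | empty => exact ⟨0, 1, SetLike.one_mem_graded 𝒜, one_ne_zero, by simp⟩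
  | insert h s _ ih =>
    obtain ⟨k, c, hc, hc0, hs⟩ := ih fun g hg => hf g (Finset.mem_insert_of_mem hg)
    obtain ⟨j, a, b, ha, hb, hb0, hab⟩ := hf h (Finset.mem_insert_self h s)
    refine ⟨j + k, b * c, SetLike.mul_mem_graded hb hc, mul_ne_zero hb0 hc0, fun g hg => ?_⟩
    rcases Finset.mem_insert.1 hg with rfl | hg
    · refine ⟨a * c, add_assoc g j k ▸ SetLike.mul_mem_graded ha hc, ?_⟩
      rw [map_mul, map_mul, ← hab, mul_assoc]
    · obtain ⟨r, hr, hfr⟩ := hs g hg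
      refine ⟨b * r, add_left_comm g j k ▸ SetLike.mul_mem_graded hb hr, ?_⟩
      rw [map_mul, map_mul, ← hfr]
      ring

/-- Homogeneous fractions of distinct degrees that sum to zero all vanish. -/
theorem eq_zero_of_sum_fracComponent_eq_zero [GradedRing 𝒜] (s : Finset G)
    (f : G → FractionRing R) (hf : ∀ g ∈ s, f g ∈ fracComponent 𝒜 g)
    (hsum : ∑ g ∈ s, f g = 0) : ∀ g ∈ s, f g = 0 := by
  obtain ⟨k, c, -, hc0, hr⟩ := exists_common_denominator s f hf
  choose! r hr hfr using hr
  have hinj := IsFractionRing.injective R (FractionRing R)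
  have hrsum : ∑ g ∈ s, r g = 0 := by
    apply hinj
    rw [map_sum, map_zero, ← Finset.sum_congr rfl hfr, ← Finset.sum_mul, hsum, zero_mul]
  intro g hg
  have hrg : r g = 0 := by
    have h : (decompose 𝒜 (∑ h ∈ s, r h) (g + k) : R) = r g := by
      rw [decompose_sum, DFinsupp.finsetSum_apply, AddSubgroup.val_finsetSum,
        Finset.sum_eq_single g]
      · exact decompose_of_mem_same 𝒜 (hr g hg)
      · exact fun h hh hne => decompose_of_mem_ne 𝒜 (hr h hh) fun e => hne (add_right_cancel e)
      · exact fun h => (h hg).elim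
    rw [← h, hrsum, decompose_zero, DirectSum.zero_apply, AddSubgroup.coe_zero]
  have h := hfr g hg
  rw [hrg, map_zero] at h
  exact (mul_eq_zero.1 h).resolve_right fun h0 => hc0 (hinj (h0.trans (map_zero _).symm))

theorem isInternal_overringComponent [GradedRing 𝒜] {S : Subalgebra R (FractionRing R)}
    (hS : IsGradedOverring 𝒜 S) : DirectSum.IsInternal (overringComponent 𝒜 S) := by
  classical
  constructor
  · refine (injective_iff_map_eq_zero _).2 fun f hf => ?_
    rw [DirectSum.coeAddMonoidHom_eq_dfinsuppSum, DFinsupp.sum] at hf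
    have h := eq_zero_of_sum_fracComponent_eq_zero (𝒜 := 𝒜) f.support
      (fun g => ((f g : S) : FractionRing R)) (fun g _ => (f g).2) (by
        simpa using congrArg (fun x : S => (x : FractionRing R)) hf)
    ext g
    by_cases hg : g ∈ f.support
    · exact h g hg
    · rw [DFinsupp.notMem_support_iff.1 hg]
      rfl
  · have hrange : ∀ x ∈ AddSubmonoid.closure {y : FractionRing R | y ∈ S ∧ IsHomFrac 𝒜 y},
        ∃ f, ((DirectSum.coeAddMonoidHom (overringComponent 𝒜 S) f : S) : FractionRing R) = x := by
      intro x hx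
      induction hx using AddSubmonoid.closure_induction with
      | mem y hy =>
        obtain ⟨g, hg⟩ := isHomFrac_iff_exists_mem_fracComponent.1 hy.2
        exact ⟨DirectSum.of (fun i => overringComponent 𝒜 S i) g ⟨⟨y, hy.1⟩, hg⟩, by
          rw [DirectSum.coeAddMonoidHom_of]⟩
      | zero => exact ⟨0, by simp⟩
      | add y z _ _ hy hz =>
        obtain ⟨f, rfl⟩ := hy
        obtain ⟨g, rfl⟩ := hz
        exact ⟨f + g, by rw [map_add]; rfl⟩
    intro x
    obtain ⟨f, hf⟩ := hrange x (hS x x.2)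
    exact ⟨f, Subtype.ext hf⟩

/-- A graded overring is a graded ring. -/
noncomputable abbrev overringGradedRing [GradedRing 𝒜] {S : Subalgebra R (FractionRing R)}
    (hS : IsGradedOverring 𝒜 S) : GradedRing (overringComponent 𝒜 S) :=
  { (isInternal_overringComponent hS).chooseDecomposition with
    one_mem := by
      have h := algebraMap_mem_overringComponent S 0 1 (SetLike.one_mem_graded 𝒜)
      rwa [map_one] at h
    mul_mem := fun _ _ _ _ hx hy => mul_mem_fracComponent hx hy }

theorem isHomIdealOver_iff [GradedRing 𝒜] {S : Subalgebra R (FractionRing R)}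
    [GradedRing (overringComponent 𝒜 S)] (I : Ideal S) :
    IsHomIdealOver 𝒜 S I ↔ I.IsHomogeneous (overringComponent 𝒜 S) := by
  rw [isHomogeneous_iff_mem_closure]
  refine forall₂_congr fun x _ => ?_
  have himage : {y : FractionRing R | IsHomFrac 𝒜 y ∧ ∃ h : y ∈ S, (⟨y, h⟩ : S) ∈ I} =
      (S.val : S →+ FractionRing R) ''
        {y : S | SetLike.IsHomogeneousElem (overringComponent 𝒜 S) y ∧ y ∈ I} := by
    ext y
    constructor
    · rintro ⟨hy, hyS, hyI⟩
      exact ⟨⟨y, hyS⟩, ⟨isHomogeneousElem_overringComponent_iff.2 hy, hyI⟩, rfl⟩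
    · rintro ⟨z, ⟨hz, hzI⟩, rfl⟩
      exact ⟨isHomogeneousElem_overringComponent_iff.1 hz, z.2, hzI⟩
  rw [himage, ← AddMonoidHom.map_mclosure]
  constructor
  · rintro ⟨z, hz, hzx⟩
    exact (Subtype.ext hzx : z = x) ▸ hz
  · exact fun hx => ⟨x, hx, rfl⟩

theorem isHomIdeal_comap [GradedRing 𝒜] {S : Subalgebra R (FractionRing R)}
    (hS : IsGradedOverring 𝒜 S) {I : Ideal S} (hI : IsHomIdealOver 𝒜 S I) :
    IsHomIdeal 𝒜 (I.comap (algebraMap R S)) := by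
  let := overringGradedRing hS
  exact (isHomogeneous_iff_mem_closure 𝒜 _).1 (isHomogeneous_comap 𝒜 (overringComponent 𝒜 S) _
    (algebraMap_mem_overringComponent S) ((isHomIdealOver_iff I).1 hI))

theorem isGrMaxIdealOver_iff_s15 [GradedRing 𝒜] {S : Subalgebra R (FractionRing R)}
    [GradedRing (overringComponent 𝒜 S)] (I : Ideal S) :
    IsGrMaxIdealOver 𝒜 S I ↔
      Maximal (fun J : Ideal S => J.IsHomogeneous (overringComponent 𝒜 S) ∧ J ≠ ⊤) I := by
  simp only [IsGrMaxIdealOver, isHomIdealOver_iff]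
  constructor
  · rintro ⟨h1, h2, h3⟩
    exact ⟨⟨h1, h2⟩, fun J hJ hle => (h3 J hJ.1 hle hJ.2).le⟩
  · rintro ⟨⟨h1, h2⟩, h3⟩
    exact ⟨h1, h2, fun J hJ hle hne => le_antisymm (h3 ⟨hJ, hne⟩ hle) hle⟩

theorem isGradedOverring_locW [GradedRing 𝒜] {W : Submonoid R}
    (hW : ∀ w ∈ W, w ≠ 0 ∧ SetLike.IsHomogeneousElem 𝒜 w) : IsGradedOverring 𝒜 (LocW W) := by
  classical
  intro x hx
  obtain ⟨r, w, hw, hrw⟩ := mem_locW_iff.1 hx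
  obtain ⟨hw0, k, hk⟩ := hW w hw
  have hw0' : algebraMap R (FractionRing R) w ≠ 0 := by simpa using hw0
  rw [eq_div_of_mul_eq hw0' hrw, ← sum_support_decompose 𝒜 r, map_sum, Finset.sum_div]
  refine sum_mem fun i _ => AddSubmonoid.subset_closure ?_
  have hmul := div_mul_cancel₀ (algebraMap R (FractionRing R) (decompose 𝒜 r i)) hw0'
  exact ⟨mem_locW_iff.2 ⟨_, w, hw, hmul⟩, i, k, _, w, SetLike.coe_mem _, hk, hw0, hmul⟩

theorem exists_mul_eq_of_mem_homLocOver [GradedRing 𝒜] {T : Subalgebra R (FractionRing R)}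
    {Q : Ideal T} (hQ : Q.IsPrime) {x : FractionRing R} (hx : x ∈ HomLocOver 𝒜 T Q) :
    ∃ s w : T, IsHomFrac 𝒜 (w : FractionRing R) ∧ w ∉ Q ∧
      x * (w : FractionRing R) = (s : FractionRing R) := by
  induction hx using Algebra.adjoin_induction with
  | mem x hx => exact hx
  | algebraMap r =>
    refine ⟨algebraMap R T r, 1, ?_, (Ideal.ne_top_iff_one Q).1 hQ.ne_top, by simp⟩
    exact ⟨0, 0, 1, 1, SetLike.one_mem_graded 𝒜, SetLike.one_mem_graded 𝒜, one_ne_zero, by simp⟩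
  | add x y _ _ hx hy =>
    obtain ⟨r, w, hwh, hw, hrw⟩ := hx
    obtain ⟨s, v, hvh, hv, hsv⟩ := hy
    refine ⟨r * v + s * w, w * v, hwh.mul hvh, hQ.mul_notMem hw hv, ?_⟩
    push_cast
    rw [← hrw, ← hsv]
    ring
  | mul x y _ _ hx hy =>
    obtain ⟨r, w, hwh, hw, hrw⟩ := hx
    obtain ⟨s, v, hvh, hv, hsv⟩ := hy
    refine ⟨r * s, w * v, hwh.mul hvh, hQ.mul_notMem hw hv, ?_⟩
    push_cast
    rw [← hrw, ← hsv]
    ring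

/-- A homogeneous element of `S` lies in the gr-valuation ring `T_(Q)`, where `T` is a
localization of `R`, as soon as some prime of `S` has the same contraction to `R` as `Q`. -/
theorem mem_homLocOver_of_comap_eq [GradedRing 𝒜] {W : Submonoid R}
    (hW : ∀ w ∈ W, w ≠ 0) {Q : Ideal (LocW W)} (hQ : Q.IsPrime)
    (hval : GrValuation 𝒜 (HomLocOver 𝒜 (LocW W) Q)) {S : Subalgebra R (FractionRing R)}
    {Qt : Ideal S} (hcomap : Qt.comap (algebraMap R S) = Q.comap (algebraMap R (LocW W)))
    {x : FractionRing R} (hxS : x ∈ S) (hx : IsHomFrac 𝒜 x) :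
    x ∈ HomLocOver 𝒜 (LocW W) Q := by
  by_contra hxQ
  have hx0 : x ≠ 0 := fun h => hxQ (h ▸ zero_mem _)
  obtain ⟨s, t, hth, htQ, hst⟩ := exists_mul_eq_of_mem_homLocOver hQ
    ((hval x hx0 hx).resolve_left hxQ)
  have hts : (t : FractionRing R) = x * s := by rw [← hst, mul_inv_cancel_left₀ hx0]
  have hsh : IsHomFrac 𝒜 (s : FractionRing R) := by
    obtain ⟨i, j, a, b, ha, hb, hb0, hab⟩ := hx
    have hb0' : algebraMap R (FractionRing R) b ≠ 0 := by simpa using hb0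
    have ha0 : a ≠ 0 := by
      rintro rfl
      rw [map_zero] at hab
      exact (mul_ne_zero hx0 hb0') hab
    rw [← hst]
    refine IsHomFrac.mul ⟨j, i, b, a, hb, ha, ha0, ?_⟩ hth
    rw [← hab, inv_mul_cancel_left₀ hx0]
  have hsQ : s ∈ Q := by
    by_contra hsQ
    exact hxQ (Algebra.subset_adjoin ⟨t, s, hsh, hsQ, hts.symm⟩)
  obtain ⟨a, u, hu, hau⟩ := mem_locW_iff.1 s.2
  obtain ⟨b, v, hv, hbv⟩ := mem_locW_iff.1 t.2
  have hau' : s * algebraMap R (LocW W) u = algebraMap R (LocW W) a := Subtype.ext hau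
  have hbv' : t * algebraMap R (LocW W) v = algebraMap R (LocW W) b := Subtype.ext hbv
  have haQ : a * v ∈ Qt.comap (algebraMap R S) := by
    rw [hcomap, Ideal.mem_comap, map_mul, ← hau']
    exact Q.mul_mem_right _ (Q.mul_mem_right _ hsQ)
  have hbQ : b * u ∈ Qt.comap (algebraMap R S) := by
    have h : algebraMap R S (b * u) = ⟨x, hxS⟩ * algebraMap R S (a * v) := by
      apply Subtype.ext
      change algebraMap R (FractionRing R) (b * u) = x * algebraMap R (FractionRing R) (a * v)
      rw [map_mul, map_mul, ← hau, ← hbv, hts]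
      ring
    rw [Ideal.mem_comap, h]
    exact Qt.mul_mem_left _ haQ
  rw [hcomap, Ideal.mem_comap, map_mul, ← hbv'] at hbQ
  have hnotMem {w : R} (hw : w ∈ W) : algebraMap R (LocW W) w ∉ Q := fun h =>
    hQ.ne_top (Ideal.eq_top_of_isUnit_mem Q h (isUnit_algebraMap_locW hW hw))
  exact hQ.mul_notMem (hQ.mul_notMem htQ (hnotMem hv)) (hnotMem hu) hbQ

/-- If all localizations of `R` at homogeneous multiplicative sets are gr-essential, then `R` is
graded perinormal. -/
theorem gradedPerinormal_of_forall_grEssentialSub [UniqueSums G] [GradedRing 𝒜]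
    (hP : ∀ W : Submonoid R, (∀ w ∈ W, w ≠ 0 ∧ SetLike.IsHomogeneousElem 𝒜 w) →
      GrEssentialSub 𝒜 (LocW W)) :
    GradedPerinormal 𝒜 := by
  rintro S hS ⟨M, hM, huniq⟩ hGD
  let : GradedRing (overringComponent 𝒜 S) := overringGradedRing hS
  have hMmax := (isGrMaxIdealOver_iff_s15 (𝒜 := 𝒜) M).1 hM
  have hMprime : M.IsPrime := isPrime_of_maximal_isHomogeneous (overringComponent 𝒜 S) hMmax
  obtain ⟨P, hPM⟩ : ∃ P : Ideal R, M.comap (algebraMap R S) = P := ⟨_, rfl⟩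
  have hPprime : P.IsPrime := hPM ▸ Ideal.comap_isPrime _ _
  have hPhom : IsHomIdeal 𝒜 P := hPM ▸ isHomIdeal_comap hS hM.1
  obtain ⟨W, hmemW⟩ : ∃ W : Submonoid R, ∀ w, w ∈ W ↔ SetLike.IsHomogeneousElem 𝒜 w ∧ w ∉ P :=
    ⟨SetLike.homogeneousSubmonoid 𝒜 ⊓ P.primeCompl, fun _ => Iff.rfl⟩
  have hW0 : ∀ w ∈ W, w ≠ 0 := fun w hw h => ((hmemW w).1 hw).2 (h ▸ P.zero_mem)
  have hW : ∀ w ∈ W, w ≠ 0 ∧ SetLike.IsHomogeneousElem 𝒜 w := fun w hw =>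
    ⟨hW0 w hw, ((hmemW w).1 hw).1⟩
  obtain ⟨I, hI, hT⟩ := hP W hW
  have hTgr : IsGradedOverring 𝒜 (LocW W) := isGradedOverring_locW hW
  have hhom : {y : FractionRing R | y ∈ S ∧ IsHomFrac 𝒜 y} ⊆ (LocW W : Set (FractionRing R)) := by
    rintro x ⟨hxS, hx⟩
    rw [hT, Set.mem_iInter₂]
    intro Q hQI
    obtain ⟨hQ, hQhom, hval⟩ := hI Q hQI
    have hQR := isHomIdeal_comap hTgr hQhom
    have hQP : Q.comap (algebraMap R (LocW W)) ≤ P :=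
      comap_locW_le hW0 (fun w h hw => (hmemW w).2 ⟨h, hw⟩) hQ hQR
    obtain ⟨Qt, -, -, -, hQt⟩ := hGD _ P M (Ideal.comap_isPrime _ _) hPprime hMprime hQR
      hPhom hM.1 hQP hPM
    exact mem_homLocOver_of_comap_eq hW0 hQ hval hQt hxS hx
  refine ⟨W, fun w hw => ?_, fun s => ?_⟩
  · obtain ⟨⟨i, hi⟩, hwP⟩ := (hmemW w).1 hw
    rw [← hPM, Ideal.mem_comap] at hwP
    exact isUnit_of_notMem_unique_maximal (overringComponent 𝒜 S)
      (fun N hN => huniq N ((isGrMaxIdealOver_iff_s15 N).2 hN))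
      ⟨i, algebraMap_mem_overringComponent S i w hi⟩ hwP
  · obtain ⟨r, w, hw, hrw⟩ := mem_locW_iff.1
      ((AddSubmonoid.closure_le (S := (LocW W).toSubsemiring.toAddSubmonoid)).2 hhom (hS s s.2))
    exact ⟨r, w, hw, Subtype.ext hrw⟩

end Overrings

/-- Every graded `P`-domain is a graded perinormal domain. -/
theorem gradedPerinormal_of_gradedPDomain
    {G : Type*} [DecidableEq G] [AddCommGroup G] (hG : ∀ g : G, g ≠ 0 → ¬IsOfFinAddOrder g)
    {R : Type*} [CommRing R] [IsDomain R]
    (𝒜 : G → AddSubgroup R) (hGr : IsGrRing 𝒜)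
    (hP : GradedPDomain 𝒜) :
    GradedPerinormal 𝒜 := by
  have : IsAddTorsionFree G := .of_not_isOfFinAddOrder hG
  have : UniqueSums G := uniqueSums_of_isAddTorsionFree G
  let : GradedRing 𝒜 :=
    { hGr.internal.chooseDecomposition with
      one_mem := hGr.one_mem
      mul_mem := fun _ _ _ _ ha hb => hGr.mul_mem ha hb }
  exact gradedPerinormal_of_forall_grEssentialSub hP.2
end
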